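/- arXiv:1611.04256 — 2 statements merged into one kernel-verified Lean document; each statement's English description precedes it below -/
import Mathlib

section
/- Let S ≤ 𝔽₂ⁿ × 𝔽₂ⁿ be a subspace and 𝓔 ⊆ {1,…,n} an erasure pattern, and suppose there exists ℓ ∈ (S^⊥ ∩ W_𝓔) with ℓ ∉ S. Then every decoder fails on at least half of the covered errors: for every function dec : (S → 𝔽₂) → 𝔽₂ⁿ × 𝔽₂ⁿ assigning an error estimate to each syndrome, one has 2 · |{e ∈ W_𝓔 : dec(σ(e)) + e ∉ S}| ≥ |W_𝓔|, where σ(e) : S → 𝔽₂ denotes the syndrome map s ↦ ω(e,s). (Hence on an uncorrectable erasure, even the optimal decoder fails with probability at least 1/2 for the uniform error distribution on W_𝓔.) -/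
/-- The symplectic form on `𝔽₂ⁿ × 𝔽₂ⁿ`:
`ω((z,x),(z',x')) = Σᵢ zᵢ x'ᵢ + Σᵢ xᵢ z'ᵢ`. -/
def symplForm {n : ℕ} (e f : (Fin n → ZMod 2) × (Fin n → ZMod 2)) : ZMod 2 :=
  (∑ i, e.1 i * f.2 i) + (∑ i, e.2 i * f.1 i)

/-- The error `e` is covered by the erasure pattern `𝓔`. -/
def coveredBy {n : ℕ} (𝓔 : Set (Fin n)) (e : (Fin n → ZMod 2) × (Fin n → ZMod 2)) : Prop :=
  ∀ i, i ∉ 𝓔 → e.1 i = 0 ∧ e.2 i = 0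

/-- on an uncorrectable erasure (one covering a non-trivial logical error `ℓ`),
every decoder `dec` from syndromes to error estimates fails (up to stabilizer) on at least
half of the covered errors. -/
theorem uncorrectable_decoder_fails_half (n : ℕ)
    (S : Submodule (ZMod 2) ((Fin n → ZMod 2) × (Fin n → ZMod 2)))
    (𝓔 : Set (Fin n)) (ℓ : (Fin n → ZMod 2) × (Fin n → ZMod 2))
    (hℓperp : ∀ s ∈ S, symplForm ℓ s = 0) (hℓcov : coveredBy 𝓔 ℓ) (hℓS : ℓ ∉ S)
    (dec : (↥S → ZMod 2) → (Fin n → ZMod 2) × (Fin n → ZMod 2)) :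
    {e | coveredBy 𝓔 e}.ncard
      ≤ 2 * {e | coveredBy 𝓔 e ∧ dec (fun s : ↥S => symplForm e s.1) + e ∉ S}.ncard := by
  have hsyn : ∀ e, (fun s : ↥S => symplForm (e - ℓ) s.1) = fun s : ↥S => symplForm e s.1 := by
    intro e
    funext s
    have h := hℓperp s.1 s.2
    have h2 : symplForm (e - ℓ) s.1 = symplForm e s.1 - symplForm ℓ s.1 := by
      simp only [symplForm, Prod.fst_sub, Prod.snd_sub, Pi.sub_apply, sub_mul,
        Finset.sum_sub_distrib]
      ring
    rw [h2, h, sub_zero]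
  set F := {e | coveredBy 𝓔 e ∧ dec (fun s : ↥S => symplForm e s.1) + e ∉ S} with hF
  have hsub : {e | coveredBy 𝓔 e} ⊆ F ∪ (fun e => e + ℓ) '' F := by
    intro e he
    by_cases hs : dec (fun s : ↥S => symplForm e s.1) + e ∈ S
    · right
      refine ⟨e - ℓ, ⟨?_, ?_⟩, sub_add_cancel e ℓ⟩
      · intro i hi
        have h1 := he i hi
        have h2 := hℓcov i hi
        simp [h1.1, h1.2, h2.1, h2.2]
      · rw [hsyn e]
        intro h
        apply hℓS
        have h3 := S.sub_mem hs h
        have h4 : ∀ d : (Fin n → ZMod 2) × (Fin n → ZMod 2), d + e - (d + (e - ℓ)) = ℓ := by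
          intro d
          abel
        rwa [h4] at h3
    · left
      exact ⟨he, hs⟩
  calc {e | coveredBy 𝓔 e}.ncard ≤ (F ∪ (fun e => e + ℓ) '' F).ncard :=
        Set.ncard_le_ncard hsub (Set.toFinite _)
    _ ≤ F.ncard + ((fun e => e + ℓ) '' F).ncard := Set.ncard_union_le _ _
    _ ≤ F.ncard + F.ncard := Nat.add_le_add_left (Set.ncard_image_le (Set.toFinite _)) _
    _ = 2 * F.ncard := (two_mul _).symm
end

section
/- Let G be a finite simple graph on vertex set V and let O ⊆ V be a set of 'open' vertices. Consider the 𝔽₂-subspace Z_O(G) of functions x : E(G) → 𝔽₂ on the edge set such that for every non-open vertex v ∉ O, the sum of x(e) over the edges e incident to v is 0 (the relative cycle space of G with open vertices O). Then dim Z_O(G) = |E(G)| − |V \ O| + κ, where κ is the number of connected components of G containing no vertex of O. -/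
open Finset

variable {V : Type*} [Fintype V] [DecidableEq V]

/-- The relative cycle space `Z_O(G)` of a graph `G` with open-vertex set `O`: functions on
the edge set whose incident sum at every non-open vertex vanishes. -/
def relCycleSpace (G : SimpleGraph V) [DecidableRel G.Adj] (O : Finset V) :
    Submodule (ZMod 2) (↥G.edgeSet → ZMod 2) where
  carrier := {x | ∀ v ∉ O,
    ∑ e ∈ univ.filter (fun e : G.edgeSet => v ∈ (e : Sym2 V)), x e = 0}
  add_mem' := by
    intro x y hx hy v hv
    simp [Finset.sum_add_distrib, hx v hv, hy v hv]
  zero_mem' := by intro v hv; simp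
  smul_mem' := by
    intro c x hx v hv
    simp [← Finset.mul_sum, hx v hv]

/-- Extension by zero of a function on the non-open vertices. -/
def relExt (O : Finset V) (y : {v : V // v ∉ O} → ZMod 2) (v : V) : ZMod 2 :=
  if h : v ∉ O then y ⟨v, h⟩ else 0

/-- Incidence matrix restricted to the non-open vertices. -/
def relInc (G : SimpleGraph V) [DecidableRel G.Adj] (O : Finset V) :
    Matrix {v : V // v ∉ O} G.edgeSet (ZMod 2) :=
  fun v e => if (v : V) ∈ (e : Sym2 V) then 1 else 0

theorem relInc_ker (G : SimpleGraph V) [DecidableRel G.Adj] (O : Finset V) :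
    LinearMap.ker (relInc G O).mulVecLin = relCycleSpace G O := by
  ext x
  simp only [LinearMap.mem_ker, Matrix.mulVecLin_apply, funext_iff, Matrix.mulVec, dotProduct,
    relInc, Subtype.forall, Pi.zero_apply, ite_mul, one_mul, zero_mul, ← Finset.sum_filter]
  rfl

theorem relInc_transpose_apply (G : SimpleGraph V) [DecidableRel G.Adj] (O : Finset V)
    (y : {v : V // v ∉ O} → ZMod 2) (a b : V) (h : G.Adj a b) :
    ((relInc G O).transpose.mulVec y) ⟨s(a, b), h⟩ = relExt O y a + relExt O y b := by
  have h1 : ((relInc G O).transpose.mulVec y) ⟨s(a, b), h⟩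
      = ∑ v : {v : V // v ∉ O}, (fun v : V => if v ∈ s(a, b) then relExt O y v else 0) v := by
    simp only [Matrix.mulVec, dotProduct, Matrix.transpose_apply, relInc, ite_mul, one_mul,
      zero_mul]
    refine Finset.sum_congr rfl fun v _ => ?_
    simp [relExt, v.2]
  have h2 : ∑ v : {v : V // v ∉ O}, (fun v : V => if v ∈ s(a, b) then relExt O y v else 0) v
      = ∑ v : V, if v ∈ s(a, b) then relExt O y v else 0 := by
    rw [← Finset.sum_subtype (univ.filter (fun v => v ∉ O)) (by simp)
      (fun v : V => if v ∈ s(a, b) then relExt O y v else 0)]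
    refine Finset.sum_subset (Finset.subset_univ _) fun v _ hv => ?_
    have hv' : v ∈ O := by simpa using hv
    simp [relExt, hv']
  rw [h1, h2, ← Finset.sum_filter]
  have h3 : univ.filter (fun v => v ∈ s(a, b)) = {a, b} := by
    ext v; simp
  rw [h3, Finset.sum_pair h.ne]

/-- Functions on closed components, pulled back to non-open vertices. -/
noncomputable def relPull (G : SimpleGraph V) (O : Finset V) :
    ({c : G.ConnectedComponent | ∀ v ∈ c.supp, v ∉ O} → ZMod 2) →ₗ[ZMod 2]
      ({v : V // v ∉ O} → ZMod 2) := by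
  classical
  exact
  { toFun := fun f v => if h : G.connectedComponentMk v ∈
      {c : G.ConnectedComponent | ∀ v ∈ c.supp, v ∉ O} then f ⟨_, h⟩ else 0
    map_add' := by
      intro f g; ext v; simp only [Pi.add_apply]; split_ifs <;> simp
    map_smul' := by
      intro f g; ext v; simp only [Pi.smul_apply, RingHom.id_apply]; split_ifs <;> simp }

theorem relPull_injective (G : SimpleGraph V) (O : Finset V) :
    Function.Injective (relPull G O) := by
  intro f g hfg
  ext ⟨c, hc⟩
  induction c using SimpleGraph.ConnectedComponent.ind with
  | h v =>
    have := congrFun hfg ⟨v, hc v rfl⟩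
    simp only [relPull, LinearMap.coe_mk, AddHom.coe_mk] at this
    rwa [dif_pos hc, dif_pos hc] at this

theorem relPull_range (G : SimpleGraph V) [DecidableRel G.Adj] (O : Finset V) :
    LinearMap.range (relPull G O) = LinearMap.ker (relInc G O).transpose.mulVecLin := by
  ext y
  rw [LinearMap.mem_ker, Matrix.mulVecLin_apply]
  constructor
  · rintro ⟨f, rfl⟩
    ext ⟨e, he⟩
    induction e using Sym2.ind with
    | h a b =>
      have hab : G.Adj a b := he
      rw [relInc_transpose_apply G O _ a b hab]
      have hc : G.connectedComponentMk a = G.connectedComponentMk b :=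
        SimpleGraph.ConnectedComponent.sound hab.reachable
      have key : ∀ v : V, relExt O (relPull G O f) v = (by
          classical exact if h : G.connectedComponentMk v ∈
            {c : G.ConnectedComponent | ∀ v ∈ c.supp, v ∉ O} then f ⟨_, h⟩ else 0) := by
        intro v
        by_cases hv : v ∉ O
        · simp only [relExt, dif_pos hv, relPull, LinearMap.coe_mk, AddHom.coe_mk]
        · rw [relExt, dif_neg hv, dif_neg]
          intro h
          exact hv (h v rfl)
      rw [key, key, Pi.zero_apply]
      simp only [hc]
      exact CharTwo.add_self_eq_zero _
  · intro hy
    have hadj : ∀ a b, G.Adj a b → relExt O y a = relExt O y b := by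
      intro a b h
      have := relInc_transpose_apply G O y a b h
      rw [hy, Pi.zero_apply] at this
      exact CharTwo.add_eq_zero.mp this.symm
    have hreach : ∀ a b, G.Reachable a b → relExt O y a = relExt O y b := by
      rintro a b ⟨p⟩
      induction p with
      | nil => rfl
      | cons h _ ih => exact (hadj _ _ h).trans ih
    refine ⟨fun c => relExt O y c.1.out, ?_⟩
    ext v
    have hv : relExt O y v = y v := by simp [relExt, v.2]
    simp only [relPull, LinearMap.coe_mk, AddHom.coe_mk]
    split_ifs with h
    · rw [← hv]
      exact hreach _ _ (SimpleGraph.ConnectedComponent.exact (Quot.out_eq _))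
    · simp only [Set.mem_ofPred_eq, not_forall, not_not] at h
      obtain ⟨w, hw, hwO⟩ := h
      rw [← hv, ← hreach w v (SimpleGraph.ConnectedComponent.exact hw), relExt,
        dif_neg (not_not.mpr hwO)]

theorem relCycleSpace_finrank (G : SimpleGraph V) [DecidableRel G.Adj] (O : Finset V) :
    Module.finrank (ZMod 2) ↥(relCycleSpace G O) + (Finset.univ \ O).card
      = G.edgeFinset.card
        + {c : G.ConnectedComponent | ∀ v ∈ c.supp, v ∉ O}.ncard := by
  classical
  have h1 := (relInc G O).mulVecLin.finrank_range_add_finrank_ker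
  have h2 := (relInc G O).transpose.mulVecLin.finrank_range_add_finrank_ker
  have h3 : Module.finrank (ZMod 2) (LinearMap.range (relInc G O).transpose.mulVecLin)
      = Module.finrank (ZMod 2) (LinearMap.range (relInc G O).mulVecLin) :=
    Matrix.rank_transpose (relInc G O)
  rw [← relPull_range, LinearMap.finrank_range_of_inj (relPull_injective G O), h3,
    Module.finrank_fintype_fun_eq_card, Module.finrank_fintype_fun_eq_card,
    ← Nat.card_eq_fintype_card, Nat.card_coe_set_eq] at h2
  rw [relInc_ker, Module.finrank_fintype_fun_eq_card] at h1
  have h4 : Fintype.card {v : V // v ∉ O} = (Finset.univ \ O).card := by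
    rw [Fintype.card_subtype]; congr 1; ext; simp
  have h5 : Fintype.card G.edgeSet = G.edgeFinset.card := by
    rw [SimpleGraph.edgeFinset_card]
  omega
end
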